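/- arXiv:2007.03507 — 4 statements merged into one kernel-verified Lean document; each statement's English description precedes it below -/
import Mathlib

section
/- Let Q be an integral m×n matrix and p ∈ ℤ^m an integral vector such that the linear system Qx ≥ p is box-TDI. Then for every rational vector z* ∈ ℚ^n, the translated system Qx ≥ p₀, where p₀ := p − Qz*, is also box-TDI. -/
open Matrix

/-- A rational linear system `A x ≥ b` is totally dual integral (TDI): for every integral
cost vector `c` for which the dual program `max {y b : y ≥ 0, y A = c}` is feasible and
bounded, the maximum is attained by an integral vector `y`. -/
def IsTDI {ι κ : Type} [Fintype ι] [Fintype κ] (A : Matrix ι κ ℚ) (b : ι → ℚ) : Prop :=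
  ∀ c : κ → ℤ,
    (∃ y : ι → ℚ, 0 ≤ y ∧ y ᵥ* A = fun j => (c j : ℚ)) →
    (∃ M : ℚ, ∀ y : ι → ℚ, 0 ≤ y → (y ᵥ* A = fun j => (c j : ℚ)) → y ⬝ᵥ b ≤ M) →
    ∃ y : ι → ℚ, (∀ i, ∃ z : ℤ, y i = z) ∧ 0 ≤ y ∧ (y ᵥ* A = fun j => (c j : ℚ)) ∧
      ∀ y' : ι → ℚ, 0 ≤ y' → (y' ᵥ* A = fun j => (c j : ℚ)) → y' ⬝ᵥ b ≤ y ⬝ᵥ b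

/-- The coefficient matrix of the system `[A x ≥ b, x ≥ f, -x ≥ -g]`. -/
def boxMatrix {ι κ : Type} [DecidableEq κ] (A : Matrix ι κ ℚ) : Matrix (ι ⊕ (κ ⊕ κ)) κ ℚ :=
  Matrix.of fun i j =>
    match i with
    | Sum.inl i => A i j
    | Sum.inr (Sum.inl i) => if i = j then 1 else 0
    | Sum.inr (Sum.inr i) => if i = j then -1 else 0

/-- The right-hand side of the system `[A x ≥ b, x ≥ f, -x ≥ -g]`. -/
def boxRHS {ι κ : Type} (b : ι → ℚ) (f g : κ → ℚ) : ι ⊕ (κ ⊕ κ) → ℚ :=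
  Sum.elim b (Sum.elim f fun j => -(g j))

/-- A rational linear system `A x ≥ b` is box-TDI: for all rational finite-valued
bounding vectors `f ≤ g`, the system `[A x ≥ b, f ≤ x ≤ g]` is TDI. -/
def IsBoxTDI {ι κ : Type} [Fintype ι] [Fintype κ] [DecidableEq κ]
    (A : Matrix ι κ ℚ) (b : ι → ℚ) : Prop :=
  ∀ f g : κ → ℚ, f ≤ g → IsTDI (boxMatrix A) (boxRHS b f g)

/-- Translating the solution set of a TDI system by a rational vector preserves TDI-ness. -/
theorem IsTDI.sub_mulVec {ι κ : Type} [Fintype ι] [Fintype κ] {A : Matrix ι κ ℚ} {b : ι → ℚ}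
    (h : IsTDI A b) (z : κ → ℚ) : IsTDI A (b - A *ᵥ z) := by
  intro c hfeas ⟨M, hM⟩
  have key (y : ι → ℚ) (hy : y ᵥ* A = fun j => (c j : ℚ)) :
      y ⬝ᵥ (b - A *ᵥ z) = y ⬝ᵥ b - (fun j => (c j : ℚ)) ⬝ᵥ z := by
    rw [dotProduct_sub, dotProduct_mulVec, hy]
  obtain ⟨y, hint, hnonneg, hy, hmax⟩ := h c hfeas
    ⟨M + (fun j => (c j : ℚ)) ⬝ᵥ z, fun y hnonneg hy => by
      have := hM y hnonneg hy
      rw [key y hy] at this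
      linarith⟩
  refine ⟨y, hint, hnonneg, hy, fun y' hnonneg' hy' => ?_⟩
  rw [key y hy, key y' hy']
  exact sub_le_sub_right (hmax y' hnonneg' hy') _

theorem boxRHS_sub_mulVec {ι κ : Type} [Fintype κ] [DecidableEq κ] (A : Matrix ι κ ℚ)
    (b : ι → ℚ) (f g z : κ → ℚ) :
    boxRHS (b - A *ᵥ z) f g = boxRHS b (f + z) (g + z) - boxMatrix A *ᵥ z := by
  ext (i | i | i)
  · simp [boxRHS, boxMatrix, mulVec, dotProduct]
  · simp [boxRHS, boxMatrix, mulVec, dotProduct]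
  · simp [boxRHS, boxMatrix, mulVec, dotProduct, ite_mul]

/-- If the integral system `Q x ≥ p` is box-TDI, then for every rational
vector `z*` the translated system `Q x ≥ p - Q z*` is box-TDI as well. -/
theorem translated_boxTDI {m n : ℕ} (Q : Matrix (Fin m) (Fin n) ℤ) (p : Fin m → ℤ)
    (hbox : IsBoxTDI (Q.map (Int.cast : ℤ → ℚ)) fun i => (p i : ℚ))
    (zstar : Fin n → ℚ) :
    IsBoxTDI (Q.map (Int.cast : ℤ → ℚ))
      ((fun i => (p i : ℚ)) - (Q.map (Int.cast : ℤ → ℚ)) *ᵥ zstar) := by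
  intro f g hfg
  rw [boxRHS_sub_mulVec]
  exact (hbox _ _ (add_le_add_left hfg zstar)).sub_mulVec zstar
end

section
/- Let Qx ≥ p be a box-TDI system (Q an integral m×n matrix, p ∈ ℤ^m) defining the polyhedron R := {x : Qx ≥ p}, let z* be an integral element of R, and set p₀ := p − Qz*. Then the system in 2n variables [(x₁, x₂) ≥ 0, Qx₂ − Qx₁ ≥ p₀] is box-TDI. -/
open Matrix

/-- The coefficient matrix of the system `[(x₁,x₂) ≥ 0, Q x₂ - Q x₁ ≥ p₀]` in the
`2n` variables `(x₁,x₂)`. -/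
def doubledMatrix {m n : ℕ} (Q : Matrix (Fin m) (Fin n) ℤ) :
    Matrix ((Fin n ⊕ Fin n) ⊕ Fin m) (Fin n ⊕ Fin n) ℚ :=
  Matrix.of fun i j =>
    match i with
    | Sum.inl i => if i = j then 1 else 0
    | Sum.inr i =>
      match j with
      | Sum.inl j => -(Q i j : ℚ)
      | Sum.inr j => (Q i j : ℚ)

/-- **Farkas' lemma** for finitely many linear functionals on a rational vector space. -/
theorem farkas_finset {V I : Type} [AddCommGroup V] [Module ℚ V] [DecidableEq I]
    (s : Finset I) (a : I → V →ₗ[ℚ] ℚ) (c : V →ₗ[ℚ] ℚ)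
    (h : ∀ x, (∀ i ∈ s, 0 ≤ a i x) → 0 ≤ c x) :
    ∃ y : I → ℚ, (∀ i, 0 ≤ y i) ∧ c = ∑ i ∈ s, y i • a i := by
  induction s using Finset.induction_on generalizing a c with
  | empty =>
    refine ⟨0, fun _ => le_rfl, ?_⟩
    ext x
    have h₁ := h x (by simp)
    have h₂ := h (-x) (by simp)
    rw [map_neg] at h₂
    simp only [Finset.sum_empty, LinearMap.zero_apply]
    linarith
  | insert k s hk ih =>
    by_cases hs : ∀ x, (∀ i ∈ s, 0 ≤ a i x) → 0 ≤ c x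
    · obtain ⟨y, hy, rfl⟩ := ih a c hs
      refine ⟨Function.update y k 0, fun i => ?_, ?_⟩
      · by_cases hi : i = k
        · simp [hi]
        · simp [hi, hy]
      · rw [Finset.sum_insert hk]
        simp only [Function.update_self, zero_smul, zero_add]
        refine Finset.sum_congr rfl fun i hi => ?_
        rw [Function.update_of_ne (by rintro rfl; exact hk hi)]
    · push Not at hs
      obtain ⟨x, hx, hcx⟩ := hs
      have hkx : a k x < 0 := by
        by_contra! hkx
        exact absurd (h x (by simpa [hkx] using hx)) (not_le.2 hcx)
      -- the functionals precomposed with the projection onto the kernel of `a k` along `x`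
      let r : ℚ := (-(a k x))⁻¹
      have hr : 0 < r := inv_pos.2 (by linarith)
      have hrk : r * a k x = -1 := by
        rw [← neg_eq_iff_eq_neg, ← mul_neg]
        exact inv_mul_cancel₀ (by linarith)
      obtain ⟨y, hy, hc⟩ := ih (fun i => a i + (r * a i x) • a k) (c + (r * c x) • a k) (by
        intro v hv
        have key := h (v + (r * a k v) • x) (by
          intro i hi
          rcases Finset.mem_insert.1 hi with rfl | hi
          · rw [map_add, map_smul, smul_eq_mul]
            refine le_of_eq ?_
            linear_combination (-(a i v)) * hrk
          · have := hv i hi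
            simp only [LinearMap.add_apply, LinearMap.smul_apply, smul_eq_mul, map_add,
              map_smul] at this ⊢
            linarith)
        simp only [LinearMap.add_apply, LinearMap.smul_apply, smul_eq_mul, map_add,
          map_smul] at key ⊢
        linarith)
      refine ⟨Function.update y k (-(r * c x) + ∑ i ∈ s, y i * (r * a i x)), fun i => ?_, ?_⟩
      · by_cases hi : i = k
        · subst hi
          rw [Function.update_self]
          have : r * c x ≤ 0 := mul_nonpos_of_nonneg_of_nonpos hr.le hcx.le
          have : 0 ≤ ∑ j ∈ s, y j * (r * a j x) :=
            Finset.sum_nonneg fun j hj => mul_nonneg (hy j) (mul_nonneg hr.le (hx j hj))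
          linarith
        · simp [hi, hy]
      · rw [Finset.sum_insert hk, Function.update_self]
        have hsum : ∑ i ∈ s, Function.update y k
            (-(r * c x) + ∑ i ∈ s, y i * (r * a i x)) i • a i = ∑ i ∈ s, y i • a i := by
          refine Finset.sum_congr rfl fun i hi => ?_
          rw [Function.update_of_ne (by rintro rfl; exact hk hi)]
        rw [hsum]
        ext v
        have := LinearMap.congr_fun hc v
        simp only [LinearMap.add_apply, LinearMap.smul_apply, smul_eq_mul, LinearMap.sum_apply,
          mul_add, Finset.sum_add_distrib] at this ⊢
        rw [add_mul, Finset.sum_mul]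
        simp only [← mul_assoc] at this ⊢
        linarith

/-- Affine Farkas' lemma: an infeasible finite system of linear inequalities has a
nonnegative certificate of infeasibility. -/
theorem farkas_affine {V I : Type} [AddCommGroup V] [Module ℚ V] [Fintype I]
    (a : I → V →ₗ[ℚ] ℚ) (b : I → ℚ) (h : ¬∃ v, ∀ i, b i ≤ a i v) :
    ∃ y : I → ℚ, (∀ i, 0 ≤ y i) ∧ (∀ v, ∑ i, y i * a i v = 0) ∧ ∑ i, y i * b i = 1 := by
  classical
  obtain ⟨y, hy, hc⟩ := farkas_finset Finset.univ
    (fun i => (a i).comp (LinearMap.fst ℚ V ℚ) - b i • LinearMap.snd ℚ V ℚ)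
    (-LinearMap.snd ℚ V ℚ) (by
      rintro ⟨v, t⟩ hv
      by_contra! ht
      simp only [LinearMap.neg_apply, LinearMap.snd_apply, neg_lt_zero] at ht
      refine h ⟨t⁻¹ • v, fun i => ?_⟩
      have := hv i (Finset.mem_univ i)
      simp only [LinearMap.sub_apply, LinearMap.comp_apply, LinearMap.fst_apply,
        LinearMap.smul_apply, LinearMap.snd_apply, smul_eq_mul] at this
      rw [map_smul, smul_eq_mul, inv_mul_eq_div, le_div_iff₀ ht]
      linarith)
  refine ⟨y, hy, fun v => ?_, ?_⟩
  · simpa [eq_comm] using LinearMap.congr_fun hc (v, 0)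
  · have := LinearMap.congr_fun hc (0, 1)
    simp only [LinearMap.neg_apply, LinearMap.snd_apply, LinearMap.sum_apply, LinearMap.smul_apply,
      LinearMap.sub_apply, LinearMap.comp_apply, LinearMap.fst_apply, map_zero, smul_eq_mul,
      zero_sub, mul_one, mul_neg, Finset.sum_neg_distrib] at this
    linarith

/-- Strong linear programming duality: if the dual program is feasible and bounded, then
there are primal and dual feasible solutions of equal value. -/
theorem exists_primal_dual_eq {ι κ : Type} [Fintype ι] [Fintype κ] (A : Matrix ι κ ℚ)
    (b : ι → ℚ) (c : κ → ℚ) (hfeas : ∃ y : ι → ℚ, 0 ≤ y ∧ y ᵥ* A = c)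
    (hbdd : ∃ M : ℚ, ∀ y : ι → ℚ, 0 ≤ y → y ᵥ* A = c → y ⬝ᵥ b ≤ M) :
    ∃ x : κ → ℚ, ∃ y : ι → ℚ, b ≤ A *ᵥ x ∧ 0 ≤ y ∧ y ᵥ* A = c ∧ y ⬝ᵥ b = c ⬝ᵥ x := by
  classical
  have weak : ∀ x : κ → ℚ, ∀ y : ι → ℚ, b ≤ A *ᵥ x → 0 ≤ y → y ᵥ* A = c →
      y ⬝ᵥ b ≤ c ⬝ᵥ x := by
    rintro x y hx hy rfl
    rw [← dotProduct_mulVec]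
    exact dotProduct_le_dotProduct_of_nonneg_left hx hy
  let a : ((ι ⊕ ι) ⊕ (κ ⊕ κ)) ⊕ Unit → ((κ → ℚ) × (ι → ℚ)) →ₗ[ℚ] ℚ :=
    Sum.elim
      (Sum.elim
        (Sum.elim
          (fun i => LinearMap.proj i ∘ₗ A.mulVecLin ∘ₗ LinearMap.fst ℚ _ _)
          (fun i => LinearMap.proj i ∘ₗ LinearMap.snd ℚ _ _))
        (Sum.elim
          (fun j => LinearMap.proj j ∘ₗ A.vecMulLinear ∘ₗ LinearMap.snd ℚ _ _)
          (fun j => -(LinearMap.proj j ∘ₗ A.vecMulLinear ∘ₗ LinearMap.snd ℚ _ _))))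
      (fun _ => dotProductBilin ℚ ℚ b ∘ₗ LinearMap.snd ℚ _ _
        - dotProductBilin ℚ ℚ c ∘ₗ LinearMap.fst ℚ _ _)
  let r : ((ι ⊕ ι) ⊕ (κ ⊕ κ)) ⊕ Unit → ℚ :=
    Sum.elim (Sum.elim (Sum.elim b 0) (Sum.elim c (-c))) 0
  by_contra hno
  obtain ⟨q, hq, hq0, hq1⟩ := farkas_affine a r (by
    rintro ⟨⟨x, y⟩, hv⟩
    have h₁ : b ≤ A *ᵥ x := fun i => by simpa [a, r] using hv (Sum.inl (Sum.inl (Sum.inl i)))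
    have h₂ : 0 ≤ y := fun i => by simpa [a, r] using hv (Sum.inl (Sum.inl (Sum.inr i)))
    have h₃ : y ᵥ* A = c := funext fun j => le_antisymm
      (by simpa [a, r] using hv (Sum.inl (Sum.inr (Sum.inr j))))
      (by simpa [a, r] using hv (Sum.inl (Sum.inr (Sum.inl j))))
    have h₄ : c ⬝ᵥ x ≤ y ⬝ᵥ b := by
      rw [dotProduct_comm y b]
      simpa [a, r] using hv (Sum.inr ())
    exact hno ⟨x, y, h₁, h₂, h₃, le_antisymm (weak x y h₁ h₂ h₃) h₄⟩)
  let l : ι → ℚ := fun i => q (Sum.inl (Sum.inl (Sum.inl i)))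
  let σ : ι → ℚ := fun i => q (Sum.inl (Sum.inl (Sum.inr i)))
  let μ : κ → ℚ := fun j => q (Sum.inl (Sum.inr (Sum.inl j))) - q (Sum.inl (Sum.inr (Sum.inr j)))
  let τ : ℚ := q (Sum.inr ())
  have hl : 0 ≤ l := fun i => hq _
  have hσ : 0 ≤ σ := fun i => hq _
  have hτ : 0 ≤ τ := hq _
  have cert : ∀ x y, l ⬝ᵥ A *ᵥ x + σ ⬝ᵥ y + μ ⬝ᵥ (y ᵥ* A) + τ * (b ⬝ᵥ y - c ⬝ᵥ x) = 0 := by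
    intro x y
    rw [← hq0 (x, y)]
    simp [a, l, σ, μ, τ, Fintype.sum_sum_type, dotProduct, sub_mul, Finset.sum_sub_distrib,
      Finset.sum_neg_distrib]
    ring
  have pos : l ⬝ᵥ b + μ ⬝ᵥ c = 1 := by
    rw [← hq1]
    simp [r, l, μ, Fintype.sum_sum_type, dotProduct, sub_mul, Finset.sum_sub_distrib,
      Finset.sum_neg_distrib]
    ring
  have hlA : l ᵥ* A = τ • c := by
    refine dotProduct_eq _ _ fun x => ?_
    have := cert x 0
    simp only [dotProduct_zero, zero_vecMul] at this
    rw [← dotProduct_mulVec, smul_dotProduct, smul_eq_mul]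
    linarith
  have hdual : ∀ y, 0 ≤ y → y ᵥ* A = c → τ * (y ⬝ᵥ b) < l ⬝ᵥ b := by
    intro y hy hyA
    have h₁ := cert 0 y
    have h₂ : 0 ≤ σ ⬝ᵥ y := dotProduct_nonneg_of_nonneg hσ hy
    simp only [mulVec_zero, dotProduct_zero, hyA] at h₁
    rw [dotProduct_comm y b]
    linarith
  obtain ⟨y, hy, hyA⟩ := hfeas
  rcases hτ.eq_or_lt with h0 | h0
  · rw [← h0, zero_smul] at hlA
    have hlb : 0 < l ⬝ᵥ b := by simpa [← h0] using hdual y hy hyA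
    obtain ⟨M, hM⟩ := hbdd
    have hyM := hM y hy hyA
    have ht : 0 ≤ (M - y ⬝ᵥ b + 1) / (l ⬝ᵥ b) := div_nonneg (by linarith) hlb.le
    have := hM (y + ((M - y ⬝ᵥ b + 1) / (l ⬝ᵥ b)) • l) (add_nonneg hy (smul_nonneg ht hl))
      (by rw [add_vecMul, smul_vecMul, hlA, hyA, smul_zero, add_zero])
    rw [add_dotProduct, smul_dotProduct, smul_eq_mul, div_mul_cancel₀ _ hlb.ne'] at this
    linarith
  · have := hdual (τ⁻¹ • l) (smul_nonneg (inv_nonneg.2 hτ) hl)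
      (by rw [smul_vecMul, hlA, smul_smul, inv_mul_cancel₀ h0.ne', one_smul])
    rw [smul_dotProduct, smul_eq_mul, mul_inv_cancel_left₀ h0.ne'] at this
    exact lt_irrefl _ this

/-- Complementary slackness: primal and dual feasible solutions have equal values if and only if
the dual solution is supported on the tight rows. -/
theorem dotProduct_eq_iff_tight {ι κ : Type} [Fintype ι] [Fintype κ] {A : Matrix ι κ ℚ}
    {b : ι → ℚ} {x : κ → ℚ} {y : ι → ℚ} (hx : b ≤ A *ᵥ x) (hy : 0 ≤ y) :
    y ⬝ᵥ b = (y ᵥ* A) ⬝ᵥ x ↔ ∀ i, y i ≠ 0 → (A *ᵥ x) i = b i := by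
  rw [← dotProduct_mulVec, dotProduct, dotProduct,
    Finset.sum_eq_sum_iff_of_le fun i _ => mul_le_mul_of_nonneg_left (hx i) (hy i)]
  refine ⟨fun h i hi => (mul_left_cancel₀ hi (h i (Finset.mem_univ i))).symm, fun h i _ => ?_⟩
  by_cases hi : y i = 0
  · simp [hi]
  · rw [h i hi]

/-- A system is TDI if every fractional dual solution supported on the rows that are tight at a
feasible point can be replaced by an integral one. -/
theorem IsTDI.of_tight {ι κ : Type} [Fintype ι] [Fintype κ] {A : Matrix ι κ ℚ} {b : ι → ℚ}
    (h : ∀ (c : κ → ℤ) (x : κ → ℚ) (y : ι → ℚ), b ≤ A *ᵥ x → 0 ≤ y →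
      (y ᵥ* A = fun j => (c j : ℚ)) → (∀ i, y i ≠ 0 → (A *ᵥ x) i = b i) →
      ∃ Y : ι → ℤ, 0 ≤ Y ∧ ((fun i => (Y i : ℚ)) ᵥ* A = fun j => (c j : ℚ)) ∧
        ∀ i, Y i ≠ 0 → (A *ᵥ x) i = b i) :
    IsTDI A b := by
  intro c hfeas hbdd
  obtain ⟨x, y, hx, hy, hyA, hval⟩ := exists_primal_dual_eq A b _ hfeas hbdd
  rw [← hyA, dotProduct_eq_iff_tight hx hy] at hval
  obtain ⟨Y, hY, hYA, htight⟩ := h c x y hx hy hyA hval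
  have hY' : (0 : ι → ℚ) ≤ fun i => (Y i : ℚ) := fun i => Int.cast_nonneg (hY i)
  refine ⟨fun i => Y i, fun i => ⟨Y i, rfl⟩, hY', hYA, fun y' hy' hy'A => ?_⟩
  rw [(dotProduct_eq_iff_tight hx hY').2 fun i hi => htight i (by simpa using hi), hYA, ← hy'A,
    ← dotProduct_mulVec]
  exact dotProduct_le_dotProduct_of_nonneg_left hx hy'

theorem boxMatrix_mulVec {ι κ : Type} [Fintype κ] [DecidableEq κ] (A : Matrix ι κ ℚ)
    (x : κ → ℚ) : boxMatrix A *ᵥ x = Sum.elim (A *ᵥ x) (Sum.elim x (-x)) := by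
  ext (i | i | i)
  · rfl
  · simp [boxMatrix, mulVec, dotProduct]
  · simp [boxMatrix, mulVec, dotProduct, ite_mul]

theorem vecMul_boxMatrix {ι κ : Type} [Fintype ι] [Fintype κ] [DecidableEq κ]
    (A : Matrix ι κ ℚ) (y : ι ⊕ (κ ⊕ κ) → ℚ) (j : κ) :
    (y ᵥ* boxMatrix A) j =
      ((fun i => y (Sum.inl i)) ᵥ* A) j + y (Sum.inr (Sum.inl j)) - y (Sum.inr (Sum.inr j)) := by
  simp [boxMatrix, vecMul, dotProduct, Fintype.sum_sum_type]
  ring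

/-- For a box-TDI system, a nonnegative combination of tight rows with prescribed integral
entries in the coordinates `J` can be chosen integral. -/
theorem IsBoxTDI.exists_int_vecMul_eq {ι κ : Type} [Fintype ι] [Fintype κ] [DecidableEq κ]
    {A : Matrix ι κ ℚ} {b : ι → ℚ} (hbox : IsBoxTDI A b) {z : κ → ℚ} (hz : b ≤ A *ᵥ z)
    {y : ι → ℚ} (hy : 0 ≤ y) (htight : ∀ i, y i ≠ 0 → (A *ᵥ z) i = b i)
    (J : Finset κ) (c : κ → ℤ) (hJ : ∀ j ∈ J, (y ᵥ* A) j = c j) :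
    ∃ Y : ι → ℤ, 0 ≤ Y ∧ (∀ i, Y i ≠ 0 → (A *ᵥ z) i = b i) ∧
      ∀ j ∈ J, ((fun i => (Y i : ℚ)) ᵥ* A) j = c j := by
  let e : κ → ℚ := fun j => if j ∈ J then 1 else 0
  have he : 0 ≤ e := fun j => by simp only [e]; split_ifs <;> simp
  have hx : boxRHS b (z - e) (z + e) ≤ boxMatrix A *ᵥ z := by
    rw [boxMatrix_mulVec]
    rintro (i | j | j)
    · exact hz i
    · have := he j
      simpa [boxRHS] using this
    · have := he j
      simpa [boxRHS] using this
  let d : κ → ℚ := fun j => c j - (y ᵥ* A) j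
  let y₀ : ι ⊕ (κ ⊕ κ) → ℚ := Sum.elim y (Sum.elim (fun j => max (d j) 0) fun j => max (-d j) 0)
  have hy₀ : 0 ≤ y₀ := by
    rintro (i | j | j)
    · exact hy i
    · exact le_max_right _ _
    · exact le_max_right _ _
  have hy₀A : y₀ ᵥ* boxMatrix A = fun j => (c j : ℚ) := by
    ext j
    rw [vecMul_boxMatrix]
    have : max (d j) 0 - max (-d j) 0 = d j := by
      rcases le_total (d j) 0 with h | h
      · rw [max_eq_right h, max_eq_left (by linarith)]; ring
      · rw [max_eq_left h, max_eq_right (by linarith)]; ring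
    simp only [y₀, Sum.elim_inl, Sum.elim_inr, d] at this ⊢
    linarith
  have hd : ∀ j ∈ J, d j = 0 := fun j hj => by simp [d, hJ j hj]
  have htight₀ : ∀ k, y₀ k ≠ 0 → (boxMatrix A *ᵥ z) k = boxRHS b (z - e) (z + e) k := by
    rw [boxMatrix_mulVec]
    rintro (i | j | j) h
    · exact htight i h
    · have : j ∉ J := fun hj => h (by simp [y₀, hd j hj])
      simp [boxRHS, e, this]
    · have : j ∉ J := fun hj => h (by simp [y₀, hd j hj])
      simp [boxRHS, e, this]
  obtain ⟨Y, hYint, hY, hYA, hYopt⟩ := hbox (z - e) (z + e)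
    (fun j => by have := he j; simp only [Pi.zero_apply] at this; simp; linarith) c
    ⟨y₀, hy₀, hy₀A⟩
    ⟨(fun j => (c j : ℚ)) ⬝ᵥ z, fun y' hy' hy'A => by
      rw [← hy'A, ← dotProduct_mulVec]
      exact dotProduct_le_dotProduct_of_nonneg_left hx hy'⟩
  have hYval : Y ⬝ᵥ boxRHS b (z - e) (z + e) = (Y ᵥ* boxMatrix A) ⬝ᵥ z := by
    refine le_antisymm ?_ ?_
    · rw [← dotProduct_mulVec]
      exact dotProduct_le_dotProduct_of_nonneg_left hx hY
    · have := hYopt y₀ hy₀ hy₀A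
      rwa [(dotProduct_eq_iff_tight hx hy₀).2 htight₀, hy₀A, ← hYA] at this
  rw [dotProduct_eq_iff_tight hx hY, boxMatrix_mulVec] at hYval
  choose W hW using hYint
  refine ⟨fun i => W (Sum.inl i), fun i => ?_, fun i hi => ?_, fun j hj => ?_⟩
  · have := hY (Sum.inl i)
    rw [hW, Pi.zero_apply] at this
    exact Int.cast_nonneg_iff.1 this
  · exact hYval (Sum.inl i) (by rw [hW]; exact_mod_cast hi)
  · have h₁ : Y (Sum.inr (Sum.inl j)) = 0 := by
      by_contra h
      have := hYval _ h
      simp only [boxRHS, e, hj, Sum.elim_inl, Sum.elim_inr, Pi.sub_apply, if_true] at this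
      linarith
    have h₂ : Y (Sum.inr (Sum.inr j)) = 0 := by
      by_contra h
      simpa [boxRHS, e, hj] using hYval _ h
    have := congrFun hYA j
    rw [vecMul_boxMatrix, h₁, h₂] at this
    simpa [hW] using this

/-- Moving from a rational number towards an integer, one stays between the two neighbouring
integers until one of them is reached. -/
theorem exists_first_int (w : ℚ) (W : ℤ) (hw : ¬∃ k : ℤ, w = k) :
    ∃ t : ℚ, 0 ≤ t ∧ t ≤ 1 ∧ (∃ k : ℤ, w + t * (W - w) = k) ∧
      ∀ s, 0 ≤ s → s ≤ t → (⌊w⌋ : ℚ) ≤ w + s * (W - w) ∧ w + s * (W - w) ≤ ⌈w⌉ := by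
  have hfl := Int.floor_le w
  have hce := Int.le_ceil w
  rcases lt_trichotomy w W with h | h | h
  · have hW : (⌈w⌉ : ℚ) ≤ W := Int.cast_le.2 (Int.ceil_le.2 h.le)
    have hpos : 0 < W - w := by linarith
    have ht : (⌈w⌉ - w) / (W - w) * (W - w) = ⌈w⌉ - w := div_mul_cancel₀ _ hpos.ne'
    refine ⟨(⌈w⌉ - w) / (W - w), div_nonneg (by linarith) hpos.le,
      (div_le_one hpos).2 (by linarith), ⟨⌈w⌉, by linarith⟩, fun s hs hst => ?_⟩
    have h₁ := mul_nonneg hs hpos.le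
    have h₂ := mul_le_mul_of_nonneg_right hst hpos.le
    constructor <;> linarith
  · exact absurd ⟨W, h⟩ hw
  · have hW : (W : ℚ) ≤ ⌊w⌋ := Int.cast_le.2 (Int.le_floor.2 h.le)
    have hpos : 0 < w - W := by linarith
    have ht : (w - ⌊w⌋) / (w - W) * (w - W) = w - ⌊w⌋ := div_mul_cancel₀ _ hpos.ne'
    refine ⟨(w - ⌊w⌋) / (w - W), div_nonneg (by linarith) hpos.le,
      (div_le_one hpos).2 (by linarith), ⟨⌊w⌋, by linarith⟩, fun s hs hst => ?_⟩
    have h₁ := mul_nonneg hs hpos.le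
    have h₂ := mul_le_mul_of_nonneg_right hst hpos.le
    constructor <;> linarith

/-- For an integral box-TDI system, a nonnegative combination of tight rows can be rounded to
an integral such combination lying between its coordinatewise floor and ceiling. -/
theorem IsBoxTDI.exists_int_rounding {ι κ : Type} [Fintype ι] [Fintype κ] [DecidableEq κ]
    (Q : Matrix ι κ ℤ) {b : ι → ℚ} (hbox : IsBoxTDI (Q.map (Int.cast : ℤ → ℚ)) b)
    {z : κ → ℚ} (hz : b ≤ Q.map (Int.cast : ℤ → ℚ) *ᵥ z)
    (y : ι → ℚ) (hy : 0 ≤ y) (htight : ∀ i, y i ≠ 0 → (Q.map (Int.cast : ℤ → ℚ) *ᵥ z) i = b i) :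
    ∃ Y : ι → ℤ, 0 ≤ Y ∧ (∀ i, Y i ≠ 0 → (Q.map (Int.cast : ℤ → ℚ) *ᵥ z) i = b i) ∧
      ∀ j, ⌊(y ᵥ* Q.map (Int.cast : ℤ → ℚ)) j⌋ ≤ (Y ᵥ* Q) j ∧
        (Y ᵥ* Q) j ≤ ⌈(y ᵥ* Q.map (Int.cast : ℤ → ℚ)) j⌉ := by
  classical
  have hcast : ∀ (Y : ι → ℤ) (j : κ),
      ((fun i => (Y i : ℚ)) ᵥ* Q.map (Int.cast : ℤ → ℚ)) j = ((Y ᵥ* Q) j : ℤ) := by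
    intro Y j
    simp [vecMul, dotProduct]
  set A := Q.map (Int.cast : ℤ → ℚ)
  induction hN : (Finset.univ.filter fun j => ¬∃ k : ℤ, (y ᵥ* A) j = k).card
    using Nat.strong_induction_on generalizing y with
  | _ N ih =>
    obtain ⟨Y, hY, hYtight, hYA⟩ := hbox.exists_int_vecMul_eq hz hy htight
      (Finset.univ.filter fun j => ∃ k : ℤ, (y ᵥ* A) j = k) (fun j => ⌊(y ᵥ* A) j⌋) (by
        intro j hj
        obtain ⟨k, hk⟩ := (Finset.mem_filter.1 hj).2
        simp [hk])
    have hYint : ∀ j, (∃ k : ℤ, (y ᵥ* A) j = k) → (y ᵥ* A) j = ((Y ᵥ* Q) j : ℤ) := by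
      rintro j ⟨k, hk⟩
      rw [← hcast, hYA j (by simp [hk])]
      simp [hk]
    rcases (Finset.univ.filter fun j => ¬∃ k : ℤ, (y ᵥ* A) j = k).eq_empty_or_nonempty with
      hemp | hne
    · refine ⟨Y, hY, hYtight, fun j => ?_⟩
      have hj : ∃ k : ℤ, (y ᵥ* A) j = k := by
        by_contra h
        exact Finset.notMem_empty j (hemp ▸ Finset.mem_filter.2 ⟨Finset.mem_univ j, h⟩)
      rw [hYint j hj]
      simp
    · choose! t ht₀ ht₁ ht₂ ht₃ using fun j => exists_first_int ((y ᵥ* A) j) ((Y ᵥ* Q) j)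
      obtain ⟨j₀, hj₀, hmin⟩ := Finset.exists_min_image _ t hne
      have hj₀' := (Finset.mem_filter.1 hj₀).2
      let y' : ι → ℚ := y + t j₀ • ((fun i => (Y i : ℚ)) - y)
      have hy'A : ∀ j, (y' ᵥ* A) j = (y ᵥ* A) j + t j₀ * ((Y ᵥ* Q) j - (y ᵥ* A) j) := by
        intro j
        simp only [y', add_vecMul, smul_vecMul, sub_vecMul, Pi.add_apply, Pi.smul_apply,
          Pi.sub_apply, hcast, smul_eq_mul]
      have hy'int : ∀ j, (∃ k : ℤ, (y ᵥ* A) j = k) → (y' ᵥ* A) j = (y ᵥ* A) j := by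
        intro j hj
        rw [hy'A, ← hYint j hj, sub_self, mul_zero, add_zero]
      have hbetween : ∀ j, (⌊(y ᵥ* A) j⌋ : ℚ) ≤ (y' ᵥ* A) j ∧ (y' ᵥ* A) j ≤ ⌈(y ᵥ* A) j⌉ := by
        intro j
        by_cases hj : ∃ k : ℤ, (y ᵥ* A) j = k
        · rw [hy'int j hj]
          exact ⟨Int.floor_le _, Int.le_ceil _⟩
        · rw [hy'A]
          exact ht₃ j hj _ (ht₀ j₀ hj₀')
            (hmin j (Finset.mem_filter.2 ⟨Finset.mem_univ j, hj⟩))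
      have hlt : (Finset.univ.filter fun j => ¬∃ k : ℤ, (y' ᵥ* A) j = k).card < N := by
        rw [← hN]
        refine Finset.card_lt_card (Finset.ssubset_iff_of_subset ?_ |>.2 ⟨j₀, hj₀, ?_⟩)
        · intro j hj
          rw [Finset.mem_filter] at hj ⊢
          refine ⟨hj.1, fun h => hj.2 ?_⟩
          rwa [hy'int j h]
        · rw [Finset.mem_filter, hy'A]
          exact fun h => h.2 (ht₂ j₀ hj₀')
      obtain ⟨Z, hZ, hZtight, hZA⟩ := ih _ hlt y'
        (by
          intro i
          have h₁ := mul_nonneg (sub_nonneg.2 (ht₁ j₀ hj₀')) (hy i)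
          have h₂ := mul_nonneg (ht₀ j₀ hj₀') (Int.cast_nonneg (R := ℚ) (hY i))
          simp only [y', Pi.add_apply, Pi.smul_apply, Pi.sub_apply, smul_eq_mul, Pi.zero_apply]
            at h₁ h₂ ⊢
          linarith)
        (by
          intro i hi
          by_cases h : y i = 0
          · refine hYtight i fun h' => hi ?_
            simp [y', h, h']
          · exact htight i h)
        rfl
      refine ⟨Z, hZ, hZtight, fun j => ⟨?_, ?_⟩⟩
      · exact (Int.le_floor.2 (hbetween j).1).trans (hZA j).1
      · exact (hZA j).2.trans (Int.ceil_le.2 (hbetween j).2)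

/-- If `d` rounds the number `s + u - v`, then `d` has an analogous integral nonnegative
decomposition with no larger support. -/
theorem exists_int_decomposition (d : ℤ) (s u v : ℚ) (hs : 0 ≤ s) (hu : 0 ≤ u) (hv : 0 ≤ v)
    (hlo : ⌊s + u - v⌋ ≤ d) (hhi : d ≤ ⌈s + u - v⌉) :
    ∃ S U V : ℤ, 0 ≤ S ∧ 0 ≤ U ∧ 0 ≤ V ∧ S + U - V = d ∧
      (S ≠ 0 → s ≠ 0) ∧ (U ≠ 0 → u ≠ 0) ∧ (V ≠ 0 → v ≠ 0) := by
  rcases lt_trichotomy d 0 with hd | hd | hd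
  · have : s + u - v < 0 := by
      by_contra! h
      exact absurd (Int.floor_nonneg.2 h) (by omega)
    exact ⟨0, 0, -d, le_rfl, le_rfl, by omega, by omega, by simp, by simp,
      fun _ => by intro h; linarith⟩
  · exact ⟨0, 0, 0, by simp [hd]⟩
  · have hpos : 0 < s + u - v := Int.ceil_pos.1 (hd.trans_le hhi)
    by_cases h : s = 0
    · exact ⟨0, d, 0, le_rfl, hd.le, le_rfl, by omega, by simp, fun _ => by intro h'; linarith,
        by simp⟩
    · exact ⟨d, 0, 0, hd.le, le_rfl, le_rfl, by omega, fun _ => h, by simp, by simp⟩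

theorem doubledMatrix_mulVec {m n : ℕ} (Q : Matrix (Fin m) (Fin n) ℤ)
    (x : Fin n ⊕ Fin n → ℚ) :
    doubledMatrix Q *ᵥ x = Sum.elim x
      (Q.map (Int.cast : ℤ → ℚ) *ᵥ fun j => x (Sum.inr j) - x (Sum.inl j)) := by
  ext (i | i)
  · simp [doubledMatrix, mulVec, dotProduct]
  · simp [doubledMatrix, mulVec, dotProduct, Fintype.sum_sum_type, mul_sub,
      Finset.sum_sub_distrib]
    ring

theorem vecMul_doubledMatrix_inl {m n : ℕ} (Q : Matrix (Fin m) (Fin n) ℤ)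
    (y : (Fin n ⊕ Fin n) ⊕ Fin m → ℚ) (j : Fin n) :
    (y ᵥ* doubledMatrix Q) (Sum.inl j) = y (Sum.inl (Sum.inl j))
      - ((fun i => y (Sum.inr i)) ᵥ* Q.map (Int.cast : ℤ → ℚ)) j := by
  simp [doubledMatrix, vecMul, dotProduct, Fintype.sum_sum_type]
  ring

theorem vecMul_doubledMatrix_inr {m n : ℕ} (Q : Matrix (Fin m) (Fin n) ℤ)
    (y : (Fin n ⊕ Fin n) ⊕ Fin m → ℚ) (j : Fin n) :
    (y ᵥ* doubledMatrix Q) (Sum.inr j) = y (Sum.inl (Sum.inr j))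
      + ((fun i => y (Sum.inr i)) ᵥ* Q.map (Int.cast : ℤ → ℚ)) j := by
  simp [doubledMatrix, vecMul, dotProduct, Fintype.sum_sum_type]

/-- If `Q x ≥ p` is box-TDI, `z*` is an integral element of
`R = {x : Q x ≥ p}` and `p₀ := p - Q z*`, then the system
`[(x₁,x₂) ≥ 0, Q x₂ - Q x₁ ≥ p₀]` is box-TDI. -/
theorem doubled_system_boxTDI {m n : ℕ} (Q : Matrix (Fin m) (Fin n) ℤ) (p : Fin m → ℤ)
    (hbox : IsBoxTDI (Q.map (Int.cast : ℤ → ℚ)) fun i => (p i : ℚ))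
    (zstar : Fin n → ℤ)
    (hz : (fun i => (p i : ℚ)) ≤ (Q.map (Int.cast : ℤ → ℚ)) *ᵥ fun j => (zstar j : ℚ)) :
    IsBoxTDI (doubledMatrix Q)
      (Sum.elim (fun _ : Fin n ⊕ Fin n => (0 : ℚ))
        ((fun i => (p i : ℚ)) - (Q.map (Int.cast : ℤ → ℚ)) *ᵥ fun j => (zstar j : ℚ))) := by
  intro f g _
  refine IsTDI.of_tight fun c x y hx hy hyA htight => ?_
  rw [boxMatrix_mulVec, doubledMatrix_mulVec] at hx htight ⊢
  let z : Fin n → ℚ := fun j => x (Sum.inr j) - x (Sum.inl j) + zstar j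
  have hQz : Q.map (Int.cast : ℤ → ℚ) *ᵥ z =
      (Q.map (Int.cast : ℤ → ℚ) *ᵥ fun j => x (Sum.inr j) - x (Sum.inl j)) +
        Q.map (Int.cast : ℤ → ℚ) *ᵥ fun j => (zstar j : ℚ) := by
    rw [← mulVec_add]
    rfl
  have hfeas : (fun i => (p i : ℚ)) ≤ Q.map (Int.cast : ℤ → ℚ) *ᵥ z := by
    intro i
    have := hx (Sum.inl (Sum.inr i))
    simp only [boxRHS, Sum.elim_inl, Sum.elim_inr, Pi.sub_apply] at this
    rw [hQz, Pi.add_apply]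
    linarith
  obtain ⟨Y, hY, hYtight, hYA⟩ := hbox.exists_int_rounding Q hfeas
    (fun i => y (Sum.inl (Sum.inr i))) (fun i => hy _) (fun i hi => by
      have := htight _ hi
      simp only [boxRHS, Sum.elim_inl, Sum.elim_inr, Pi.sub_apply] at this
      rw [hQz, Pi.add_apply]
      linarith)
  let D : Fin n ⊕ Fin n → ℤ :=
    Sum.elim (fun j => c (Sum.inl j) + (Y ᵥ* Q) j) (fun j => c (Sum.inr j) - (Y ᵥ* Q) j)
  have hD : ∀ k, ∃ S U V : ℤ, 0 ≤ S ∧ 0 ≤ U ∧ 0 ≤ V ∧ S + U - V = D k ∧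
      (S ≠ 0 → y (Sum.inl (Sum.inl k)) ≠ 0) ∧ (U ≠ 0 → y (Sum.inr (Sum.inl k)) ≠ 0) ∧
      (V ≠ 0 → y (Sum.inr (Sum.inr k)) ≠ 0) := by
    intro k
    have hk := congrFun hyA k
    rw [vecMul_boxMatrix] at hk
    refine exists_int_decomposition (D k) _ _ _ (hy _) (hy _) (hy _) ?_ ?_
    all_goals
      rcases k with j | j
      · rw [vecMul_doubledMatrix_inl] at hk
        rw [show y (Sum.inl (Sum.inl (Sum.inl j))) + y (Sum.inr (Sum.inl (Sum.inl j)))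
            - y (Sum.inr (Sum.inr (Sum.inl j))) = (c (Sum.inl j) : ℚ) +
            ((fun i => y (Sum.inl (Sum.inr i))) ᵥ* Q.map (Int.cast : ℤ → ℚ)) j by linarith]
        simp only [Int.floor_intCast_add, Int.ceil_intCast_add, D, Sum.elim_inl]
        have := hYA j
        omega
      · rw [vecMul_doubledMatrix_inr] at hk
        rw [show y (Sum.inl (Sum.inl (Sum.inr j))) + y (Sum.inr (Sum.inl (Sum.inr j)))
            - y (Sum.inr (Sum.inr (Sum.inr j))) = (c (Sum.inr j) : ℚ) +
            -((fun i => y (Sum.inl (Sum.inr i))) ᵥ* Q.map (Int.cast : ℤ → ℚ)) j by linarith]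
        simp only [Int.floor_intCast_add, Int.ceil_intCast_add, Int.floor_neg, Int.ceil_neg, D,
          Sum.elim_inr]
        have := hYA j
        omega
  choose S U V hS hU hV hSUV hS' hU' hV' using hD
  have hcast : ∀ j, ((fun i => (Y i : ℚ)) ᵥ* Q.map (Int.cast : ℤ → ℚ)) j = ((Y ᵥ* Q) j : ℤ) := by
    intro j
    simp [vecMul, dotProduct]
  refine ⟨Sum.elim (Sum.elim S Y) (Sum.elim U V), ?_, ?_, ?_⟩
  · rintro ((k | i) | k | k)
    exacts [hS k, hY i, hU k, hV k]
  · ext k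
    rw [vecMul_boxMatrix]
    have hk : (S k : ℚ) + U k - V k = D k := by exact_mod_cast hSUV k
    rcases k with j | j
    · rw [vecMul_doubledMatrix_inl]
      simp only [Sum.elim_inl, Sum.elim_inr, hcast]
      simp only [D, Sum.elim_inl, Int.cast_add] at hk
      linarith
    · rw [vecMul_doubledMatrix_inr]
      simp only [Sum.elim_inl, Sum.elim_inr, hcast]
      simp only [D, Sum.elim_inr, Int.cast_sub] at hk
      linarith
  · rintro ((k | i) | k | k) h
    · exact htight _ (hS' k h)
    · have := hYtight i h
      rw [hQz, Pi.add_apply] at this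
      simp only [boxRHS, Sum.elim_inl, Sum.elim_inr, Pi.sub_apply]
      linarith
    · exact htight _ (hU' k h)
    · exact htight _ (hV' k h)
end

section
/- Let Q be an integral matrix whose columns are indexed by a finite set S, let p be an integral vector, and suppose the linear system Qx ≥ p is box-TDI, defining R := {x : Qx ≥ p} ⊆ ℝ^S. Let z* be an integral element of R, and let ℓ : S → ℤ ∪ {−∞} and u : S → ℤ ∪ {+∞} be bounding vectors with ℓ ≤ u. Then there exists an integer-valued cost-function w* on S with ℓ ≤ w* ≤ u such that z* is a w*-minimizer of R (i.e., w*z* ≤ w*x for every x ∈ R) if and only if ℓ̃(S⁻) ≤ ũ(S⁺) holds (in the extended integers) for every pair (S⁻, S⁺) of disjoint subsets of S for which z* + χ_{S⁺} − χ_{S⁻} ∈ R, where χ_X denotes the characteristic vector of X ⊆ S and ℓ̃(X) := Σ_{s∈X} ℓ(s), ũ(X) := Σ_{s∈X} u(s). -/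
open Matrix

/-- A bounded polyhedron `A x ≥ b` has, below any of its points (with respect to a linear
functional `c`), a point at which the tight rows of `A` have trivial common kernel. -/
theorem exists_tight_kernel_trivial {ι κ : Type} [Fintype ι] [Fintype κ]
    (A : Matrix ι κ ℚ) (b : ι → ℚ) (hA : ∀ v : κ → ℚ, v ≠ 0 → ∃ i, (A *ᵥ v) i < 0)
    (c x : κ → ℚ) (hx : b ≤ A *ᵥ x) :
    ∃ x', b ≤ A *ᵥ x' ∧ c ⬝ᵥ x' ≤ c ⬝ᵥ x ∧
      ∀ v : κ → ℚ, (∀ i, (A *ᵥ x') i = b i → (A *ᵥ v) i = 0) → v = 0 := by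
  classical
  induction hn : {i | (A *ᵥ x) i ≠ b i}.toFinset.card using Nat.strong_induction_on
    generalizing x with
  | _ n ih =>
    by_cases hv : ∀ v : κ → ℚ, (∀ i, (A *ᵥ x) i = b i → (A *ᵥ v) i = 0) → v = 0
    · exact ⟨x, hx, le_rfl, hv⟩
    obtain ⟨v, hvt, hv0, hcv⟩ : ∃ v : κ → ℚ,
        (∀ i, (A *ᵥ x) i = b i → (A *ᵥ v) i = 0) ∧ v ≠ 0 ∧ c ⬝ᵥ v ≤ 0 := by
      push Not at hv
      obtain ⟨v, hvt, hv0⟩ := hv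
      rcases le_total (c ⬝ᵥ v) 0 with h | h
      · exact ⟨v, hvt, hv0, h⟩
      · refine ⟨-v, fun i hi => ?_, neg_ne_zero.mpr hv0, ?_⟩
        · rw [mulVec_neg, Pi.neg_apply, hvt i hi, neg_zero]
        · rw [dotProduct_neg]
          linarith
    obtain ⟨i₀, hi₀⟩ := hA v hv0
    obtain ⟨k, hk, hmin⟩ := Finset.exists_min_image
      (Finset.univ.filter fun i => (A *ᵥ v) i < 0)
      (fun i => ((A *ᵥ x) i - b i) / (-(A *ᵥ v) i)) ⟨i₀, by simpa using hi₀⟩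
    simp only [Finset.mem_filter, Finset.mem_univ, true_and] at hk hmin
    set t := ((A *ᵥ x) k - b k) / (-(A *ᵥ v) k) with ht
    have ht0 : 0 ≤ t := div_nonneg (sub_nonneg.mpr (hx k)) (by linarith)
    have hval : ∀ i, (A *ᵥ (x + t • v)) i = (A *ᵥ x) i + t * (A *ᵥ v) i := fun i => by
      simp [mulVec_add, mulVec_smul]
    have hfeas : b ≤ A *ᵥ (x + t • v) := by
      intro i
      rw [hval]
      rcases lt_or_ge ((A *ᵥ v) i) 0 with h | h
      · have := hmin i h
        rw [le_div_iff₀ (by linarith)] at this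
        linarith
      · have := mul_nonneg ht0 h
        have := hx i
        linarith
    have hkt : (A *ᵥ (x + t • v)) k = b k := by
      rw [hval, ht]
      have : (A *ᵥ v) k ≠ 0 := hk.ne
      field_simp
      ring
    have hkx : (A *ᵥ x) k ≠ b k := fun h => hk.ne (hvt k h)
    obtain ⟨x', h₁, h₂, h₃⟩ := ih _ (by
      rw [← hn]
      refine Finset.card_lt_card (Finset.ssubset_iff_of_subset ?_ |>.mpr ⟨k, ?_, ?_⟩)
      · intro i
        simp only [Set.mem_toFinset, Set.mem_ofPred_eq]
        intro hi h
        exact hi (by rw [hval, hvt i h, h, mul_zero, add_zero])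
      · simpa using hkx
      · simpa using hkt) (x + t • v) hfeas rfl
    refine ⟨x', h₁, h₂.trans ?_, h₃⟩
    rw [dotProduct_add, dotProduct_smul, smul_eq_mul]
    nlinarith

/-- A point of an integral TDI system at which the tight rows have trivial common kernel
is integral. -/
theorem IsTDI.integral_of_tight_kernel_trivial {ι κ : Type} [Fintype ι] [Fintype κ]
    {A : Matrix ι κ ℤ} {b : ι → ℤ}
    (h : IsTDI (A.map (Int.cast : ℤ → ℚ)) fun i => (b i : ℚ)) {x : κ → ℚ}
    (hx : (fun i => (b i : ℚ)) ≤ A.map (Int.cast : ℤ → ℚ) *ᵥ x)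
    (hker : ∀ v : κ → ℚ, (∀ i, (A.map (Int.cast : ℤ → ℚ) *ᵥ x) i = b i →
      (A.map (Int.cast : ℤ → ℚ) *ᵥ v) i = 0) → v = 0) (j : κ) :
    ∃ z : ℤ, x j = z := by
  classical
  set B : Matrix ι κ ℚ := A.map (Int.cast : ℤ → ℚ) with hB
  set I : Type := {i : ι // (B *ᵥ x) i = b i}
  set T : Matrix I κ ℚ := B.submatrix Subtype.val id with hT
  have hinj : LinearMap.ker T.mulVecLin = ⊥ := by
    rw [LinearMap.ker_eq_bot']
    intro v hv
    refine hker v fun i hi => ?_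
    exact congrFun hv ⟨i, hi⟩
  obtain ⟨G, hG⟩ := T.mulVecLin.exists_leftInverse_of_injective hinj
  set μ : I → ℚ := LinearMap.toMatrix' G j with hμ
  have hGT : LinearMap.toMatrix' G * T = 1 := by
    rw [← LinearMap.toMatrix'_toLin' T, ← LinearMap.toMatrix'_comp, toLin'_apply', hG,
      LinearMap.toMatrix'_id]
  have hμT : μ ᵥ* T = Pi.single j 1 := by
    have : (LinearMap.toMatrix' G * T) j = Pi.single j 1 := by
      rw [hGT]
      ext i
      simp [Matrix.one_apply, Pi.single_apply, eq_comm]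
    rw [← this]
    rfl
  obtain ⟨K, hK⟩ : ∃ K : ℕ, ∀ i, -μ i ≤ K := by
    obtain ⟨K, hK⟩ := exists_nat_ge (∑ i, |μ i|)
    exact ⟨K, fun i => (neg_le_abs _).trans <|
      (Finset.single_le_sum (f := fun i => |μ i|) (fun i _ => abs_nonneg _)
        (Finset.mem_univ i)).trans hK⟩
  set y₀ : ι → ℚ := fun i => if hi : (B *ᵥ x) i = b i then K + μ ⟨i, hi⟩ else 0 with hy₀
  set a : κ → ℤ := fun s => ∑ i : I, A i s with ha
  have hsum : ∀ F : ι → ℚ, ∑ i, y₀ i * F i = ∑ i : I, (K + μ i) * F i := by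
    intro F
    have h1 : ∀ i : I, (K + μ i) * F i = y₀ i * F i := fun i => by
      simp only [hy₀, dif_pos i.2]
      rfl
    simp only [h1]
    rw [← Finset.sum_filter_of_ne (p := fun i => (B *ᵥ x) i = b i)]
    · exact Finset.sum_subtype _ (by simp) _
    · intro i _ hi
      by_contra h2
      simp [hy₀, h2] at hi
  have hy₀A : y₀ ᵥ* B = fun s => ((K * a s + (Pi.single j 1 : κ → ℤ) s : ℤ) : ℚ) := by
    ext s
    have h1 := congrFun hμT s
    simp only [vecMul, dotProduct] at h1 ⊢
    rw [hsum]
    simp only [add_mul, Finset.sum_add_distrib, ← Finset.mul_sum]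
    have h2 : ∑ i : I, μ i * B i s = ((Pi.single j 1 : κ → ℤ) s : ℚ) := by
      rw [show ∑ i : I, μ i * B i s = ∑ i : I, μ i * T i s from rfl, h1]
      simp [Pi.single_apply]
    rw [h2]
    simp [ha, hB]
  have hweak : ∀ y : ι → ℚ, 0 ≤ y → y ⬝ᵥ (fun i => (b i : ℚ)) ≤ (y ᵥ* B) ⬝ᵥ x := by
    intro y hy
    rw [← dotProduct_mulVec]
    exact dotProduct_le_dotProduct_of_nonneg_left hx hy
  have hy₀0 : 0 ≤ y₀ := by
    intro i
    simp only [hy₀]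
    split_ifs with hi
    · have := hK ⟨i, hi⟩
      simp only [Pi.zero_apply]
      linarith
    · exact le_rfl
  have hy₀b : y₀ ⬝ᵥ (fun i => (b i : ℚ)) = (y₀ ᵥ* B) ⬝ᵥ x := by
    rw [← dotProduct_mulVec]
    refine Finset.sum_congr rfl fun i _ => ?_
    by_cases hi : (B *ᵥ x) i = b i
    · rw [hi]
    · simp [hy₀, hi]
  obtain ⟨y, hyint, hy0, hyA, hyopt⟩ := h _ ⟨y₀, hy₀0, hy₀A⟩
    ⟨(y₀ ᵥ* B) ⬝ᵥ x, fun y hy hyA => (hweak y hy).trans_eq (by rw [hyA, hy₀A])⟩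
  choose Y hY using hyint
  have hval : y ⬝ᵥ (fun i => (b i : ℚ)) = (y₀ ᵥ* B) ⬝ᵥ x :=
    le_antisymm ((hweak y hy0).trans_eq (by rw [hyA, hy₀A]))
      (hy₀b.symm.trans_le (hyopt y₀ hy₀0 hy₀A))
  have hax : ∑ s, (a s : ℚ) * x s = ∑ i : I, (b i : ℚ) := by
    have : ∀ i : I, (b i : ℚ) = ∑ s, (A i s : ℚ) * x s := fun i => i.2.symm
    simp only [this, ha, Int.cast_sum, Finset.sum_mul]
    exact Finset.sum_comm
  refine ⟨∑ i, Y i * b i - K * ∑ i : I, b i, ?_⟩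
  have hcalc : (y₀ ᵥ* B) ⬝ᵥ x = K * ∑ s, (a s : ℚ) * x s + x j := by
    rw [hy₀A]
    simp [dotProduct, add_mul, Finset.sum_add_distrib, Finset.mul_sum, mul_assoc,
      Pi.single_apply]
  rw [hcalc, hax] at hval
  have hYb : y ⬝ᵥ (fun i => (b i : ℚ)) = ∑ i, (Y i : ℚ) * b i := by
    simp [dotProduct, hY]
  push_cast
  rw [← hYb, hval]
  ring

/-- A set of rational vectors whose intersection with any integral box contains, below any
of its points with respect to any linear functional, an integral point. -/
def IsBoxIntegral {S : Type} [Fintype S] (R : Set (S → ℚ)) : Prop :=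
  ∀ (f g : S → ℤ) (c x : S → ℚ), x ∈ R → (∀ s, f s ≤ x s ∧ x s ≤ g s) →
    ∃ z : S → ℤ, (fun s => (z s : ℚ)) ∈ R ∧ (∀ s, f s ≤ z s ∧ z s ≤ g s) ∧
      ∑ s, c s * z s ≤ ∑ s, c s * x s

theorem IsBoxTDI.isBoxIntegral {ι S : Type} [Fintype ι] [Fintype S] [DecidableEq S]
    {Q : Matrix ι S ℤ} {p : ι → ℤ}
    (h : IsBoxTDI (Q.map (Int.cast : ℤ → ℚ)) fun i => (p i : ℚ)) :
    IsBoxIntegral {x : S → ℚ | (fun i => (p i : ℚ)) ≤ Q.map (Int.cast : ℤ → ℚ) *ᵥ x} := by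
  intro f g c x hx hfg
  set A : Matrix (ι ⊕ (S ⊕ S)) S ℤ := Matrix.of fun i j =>
    match i with
    | Sum.inl i => Q i j
    | Sum.inr (Sum.inl i) => if i = j then 1 else 0
    | Sum.inr (Sum.inr i) => if i = j then -1 else 0 with hA
  set b : ι ⊕ (S ⊕ S) → ℤ := Sum.elim p (Sum.elim f fun j => -(g j)) with hb
  have hAQ : boxMatrix (Q.map (Int.cast : ℤ → ℚ)) = A.map (Int.cast : ℤ → ℚ) := by
    ext (i | i | i) j <;> simp [boxMatrix, hA]
  have hbQ : boxRHS (fun i => (p i : ℚ)) (fun s => (f s : ℚ)) (fun s => (g s : ℚ)) =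
      fun i => (b i : ℚ) := by
    ext (i | i | i) <;> simp [boxRHS, hb]
  have hmem : ∀ v : S → ℚ, (fun i => (b i : ℚ)) ≤ A.map (Int.cast : ℤ → ℚ) *ᵥ v ↔
      (fun i => (p i : ℚ)) ≤ Q.map (Int.cast : ℤ → ℚ) *ᵥ v ∧
        ∀ s, f s ≤ v s ∧ v s ≤ g s := by
    intro v
    simp [Pi.le_def, hA, hb, mulVec, dotProduct, forall_and]
  have htdi := h (fun s => (f s : ℚ)) (fun s => (g s : ℚ))
    fun s => (hfg s).1.trans (hfg s).2
  rw [hAQ, hbQ] at htdi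
  obtain ⟨x', hx', hc, hker⟩ := exists_tight_kernel_trivial (A.map (Int.cast : ℤ → ℚ))
    (fun i => (b i : ℚ)) (fun v hv => by
      obtain ⟨s, hs⟩ := Function.ne_iff.mp hv
      rcases lt_or_gt_of_ne hs with hs | hs
      · exact ⟨Sum.inr (Sum.inl s), by simpa [hA, mulVec, dotProduct] using hs⟩
      · exact ⟨Sum.inr (Sum.inr s), by simpa [hA, mulVec, dotProduct] using hs⟩)
    c x ((hmem x).2 ⟨hx, hfg⟩)
  choose z hz using htdi.integral_of_tight_kernel_trivial hx' hker
  obtain rfl : x' = fun s => (z s : ℚ) := funext hz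
  obtain ⟨h₁, h₂⟩ := (hmem _).1 hx'
  exact ⟨z, h₁, fun s => by exact_mod_cast h₂ s, hc⟩

/-- If every integral feasible step in `{-1, 0, 1}^S` has nonnegative cost for the convex
piecewise linear cost given by `ℓ ≤ u`, then so has every feasible step. -/
theorem IsBoxIntegral.step_cost_nonneg {S : Type} [Fintype S] {R : Set (S → ℚ)}
    (hR : IsBoxIntegral R) (hconv : Convex ℚ R) {z : S → ℤ}
    (hz : (fun s => (z s : ℚ)) ∈ R) {ℓ u : S → ℤ} (hlu : ℓ ≤ u)
    (h : ∀ d : S → ℤ, (∀ s, -1 ≤ d s ∧ d s ≤ 1) → (fun s => ((z s + d s : ℤ) : ℚ)) ∈ R →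
      0 ≤ ∑ s, max (u s * d s) (ℓ s * d s))
    (x : S → ℚ) (hx : (fun s => z s + x s) ∈ R) :
    0 ≤ ∑ s, max (u s * x s) (ℓ s * x s) := by
  wlog hx1 : ∀ s, |x s| ≤ 1 generalizing x
  · set N : ℚ := 1 + ∑ s, |x s| with hN
    have hN1 : 1 ≤ N := by
      have : 0 ≤ ∑ s, |x s| := Finset.sum_nonneg fun s _ => abs_nonneg _
      linarith
    have hN0 : 0 < N := by linarith
    have hxN : ∀ s, |x s| ≤ N := fun s => by
      have := Finset.single_le_sum (f := fun s => |x s|) (fun s _ => abs_nonneg _)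
        (Finset.mem_univ s)
      linarith
    have := this (fun s => N⁻¹ * x s) (by
      have := hconv hz hx (a := 1 - N⁻¹) (b := N⁻¹)
        (sub_nonneg.mpr (inv_le_one_of_one_le₀ hN1)) (by positivity) (by ring)
      convert this using 1
      ext s
      simp only [Pi.add_apply, Pi.smul_apply, smul_eq_mul]
      ring) (fun s => by
        rw [abs_mul, abs_of_pos (inv_pos.mpr hN0), inv_mul_le_iff₀ hN0, mul_one]
        exact hxN s)
    have hs : ∀ s, max (u s * (N⁻¹ * x s)) (ℓ s * (N⁻¹ * x s)) =
        N⁻¹ * max (u s * x s) (ℓ s * x s) := fun s => by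
      rw [mul_max_of_nonneg _ _ (by positivity)]
      congr 1 <;> ring
    simp only [hs, ← Finset.mul_sum] at this
    exact nonneg_of_mul_nonneg_right this (by positivity)
  obtain ⟨y, hyR, hy, hyc⟩ := hR (fun s => z s + if x s < 0 then -1 else 0)
    (fun s => z s + if 0 < x s then 1 else 0) (fun s => if 0 < x s then u s else ℓ s)
    _ hx (fun s => by
      have := abs_le.mp (hx1 s)
      constructor <;> push_cast <;> split_ifs <;> linarith)
  have hd : ∀ s, (-1 ≤ y s - z s ∧ y s - z s ≤ 1) ∧
      (0 < x s → 0 ≤ y s - z s) ∧ (¬ 0 < x s → y s - z s ≤ 0) := fun s => by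
    have := hy s
    split_ifs at this <;>
      first
      | (exfalso; linarith)
      | (refine ⟨⟨by lia, by lia⟩, fun _ => by lia, fun _ => by lia⟩)
  have key := h (fun s => y s - z s) (fun s => (hd s).1) (by simpa using hyR)
  have e1 : ((∑ s, max (u s * (y s - z s)) (ℓ s * (y s - z s)) : ℤ) : ℚ) =
      ∑ s, (if 0 < x s then (u s : ℚ) else ℓ s) * (y s - z s) := by
    push_cast
    refine Finset.sum_congr rfl fun s _ => ?_
    have hl : (ℓ s : ℚ) ≤ u s := by exact_mod_cast hlu s
    split_ifs with hs
    · have : (0 : ℚ) ≤ y s - z s := by exact_mod_cast (hd s).2.1 hs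
      exact max_eq_left (mul_le_mul_of_nonneg_right hl this)
    · have : (y s - z s : ℚ) ≤ 0 := by exact_mod_cast (hd s).2.2 hs
      exact max_eq_right (mul_le_mul_of_nonpos_right hl this)
  have e2 : ∑ s, max (u s * x s) (ℓ s * x s) =
      ∑ s, (if 0 < x s then (u s : ℚ) else ℓ s) * x s := by
    refine Finset.sum_congr rfl fun s _ => ?_
    have hl : (ℓ s : ℚ) ≤ u s := by exact_mod_cast hlu s
    split_ifs with hs
    · exact max_eq_left (mul_le_mul_of_nonneg_right hl hs.le)
    · exact max_eq_right (mul_le_mul_of_nonpos_right hl (not_lt.mp hs))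
  have key' : (0 : ℚ) ≤ ((∑ s, max (u s * (y s - z s)) (ℓ s * (y s - z s)) : ℤ) : ℚ) := by
    exact_mod_cast key
  rw [e1] at key'
  rw [e2]
  simp only [mul_add, mul_sub, Finset.sum_add_distrib, Finset.sum_sub_distrib] at key' hyc
  linarith

/-- For finite integral bounds `ℓ ≤ u` and a convex box-integral set `R`, nonnegativity of
the cost of all integral unit steps yields an integral cost function between the bounds
that is minimized over `R` at `z`. -/
theorem IsBoxIntegral.exists_cost_of_finite_bounds {S : Type} [Fintype S]
    {R : Set (S → ℚ)} (hR : IsBoxIntegral R) (hconv : Convex ℚ R) {z : S → ℤ}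
    (hz : (fun s => (z s : ℚ)) ∈ R) (ℓ u : S → ℤ) (hlu : ℓ ≤ u)
    (h : ∀ d : S → ℤ, (∀ s, -1 ≤ d s ∧ d s ≤ 1) → (fun s => ((z s + d s : ℤ) : ℚ)) ∈ R →
      0 ≤ ∑ s, max (u s * d s) (ℓ s * d s)) :
    ∃ w : S → ℤ, (∀ s, ℓ s ≤ w s ∧ w s ≤ u s) ∧
      ∀ x : S → ℚ, (fun s => z s + x s) ∈ R → 0 ≤ ∑ s, (w s : ℚ) * x s := by
  classical
  induction hn : (∑ s, (u s - ℓ s)).toNat using Nat.strong_induction_on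
    generalizing ℓ u with
  | _ n ih =>
  have hall := hR.step_cost_nonneg hconv hz hlu h
  by_cases heq : ∀ s, ℓ s = u s
  · exact ⟨ℓ, fun s => ⟨le_rfl, (heq s).le⟩, fun x hx => by simpa [heq] using hall x hx⟩
  push Not at heq
  obtain ⟨t, ht⟩ := heq
  have htlt : ℓ t < u t := lt_of_le_of_ne (hlu t) ht
  have hpos : ∀ ℓ u : S → ℤ, ℓ ≤ u → 0 ≤ ∑ s, (u s - ℓ s) := fun ℓ u h =>
    Finset.sum_nonneg fun s _ => sub_nonneg.mpr (h s)
  by_cases hL : ∀ d : S → ℤ, (∀ s, -1 ≤ d s ∧ d s ≤ 1) →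
      (fun s => ((z s + d s : ℤ) : ℚ)) ∈ R →
      0 ≤ ∑ s, max (u s * d s) ((ℓ + Pi.single t 1 : S → ℤ) s * d s)
  · have hle : ℓ + Pi.single t 1 ≤ u := fun s => by
      have := hlu s
      by_cases hs : s = t
      · subst hs; simp; lia
      · simpa [hs] using this
    obtain ⟨w, hw, hmin⟩ := ih _ (by
      have h0 := hpos _ _ hle
      rw [← hn]
      simp only [Pi.add_apply, Finset.sum_sub_distrib, Finset.sum_add_distrib,
        Finset.sum_pi_single', Finset.mem_univ, if_true] at h0 ⊢
      lia) _ u hle hL rfl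
    refine ⟨w, fun s => ⟨le_trans ?_ (hw s).1, (hw s).2⟩, hmin⟩
    simp only [Pi.add_apply, Pi.single_apply]
    split_ifs <;> lia
  by_cases hU : ∀ d : S → ℤ, (∀ s, -1 ≤ d s ∧ d s ≤ 1) →
      (fun s => ((z s + d s : ℤ) : ℚ)) ∈ R →
      0 ≤ ∑ s, max ((u - Pi.single t 1 : S → ℤ) s * d s) (ℓ s * d s)
  · have hle : ℓ ≤ u - Pi.single t 1 := fun s => by
      have := hlu s
      by_cases hs : s = t
      · subst hs; simp; lia
      · simpa [hs] using this
    obtain ⟨w, hw, hmin⟩ := ih _ (by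
      have h0 := hpos _ _ hle
      rw [← hn]
      simp only [Pi.sub_apply, Finset.sum_sub_distrib,
        Finset.sum_pi_single', Finset.mem_univ, if_true] at h0 ⊢
      lia) ℓ _ hle hU rfl
    refine ⟨w, fun s => ⟨(hw s).1, le_trans (hw s).2 ?_⟩, hmin⟩
    simp only [Pi.sub_apply, Pi.single_apply]
    split_ifs <;> lia
  exfalso
  push Not at hL hU
  obtain ⟨d, hd1, hdR, hd⟩ := hL
  obtain ⟨e, he1, heR, he⟩ := hU
  have hdle : ∀ s, max (u s * d s) (ℓ s * d s) - (if s = t then 1 else 0) ≤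
      max (u s * d s) ((ℓ + Pi.single t 1 : S → ℤ) s * d s) := fun s => by
    by_cases hs : s = t
    · subst hs
      have h1 := hd1 s
      obtain h | h | h : d s = -1 ∨ d s = 0 ∨ d s = 1 := by lia
      all_goals simp [h]
      all_goals lia
    · simp [hs]
  have hele : ∀ s, max (u s * e s) (ℓ s * e s) - (if s = t then 1 else 0) ≤
      max ((u - Pi.single t 1 : S → ℤ) s * e s) (ℓ s * e s) := fun s => by
    by_cases hs : s = t
    · subst hs
      have h1 := he1 s
      obtain h | h | h : e s = -1 ∨ e s = 0 ∨ e s = 1 := by lia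
      all_goals simp [h]
      all_goals lia
    · simp [hs]
  have hdt : d t = -1 := by
    by_contra hne
    refine (h d hd1 hdR).not_gt (lt_of_le_of_lt (Finset.sum_le_sum fun s _ => ?_) hd)
    by_cases hs : s = t
    · subst hs
      have h1 := hd1 s
      obtain h | h : d s = 0 ∨ d s = 1 := by lia
      all_goals simp [h]
      all_goals lia
    · simp [hs]
  have het : e t = 1 := by
    by_contra hne
    refine (h e he1 heR).not_gt (lt_of_le_of_lt (Finset.sum_le_sum fun s _ => ?_) he)
    by_cases hs : s = t
    · subst hs
      have h1 := he1 s
      obtain h | h : e s = -1 ∨ e s = 0 := by lia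
      all_goals simp [h]
      all_goals lia
    · simp [hs]
  have hd0 := Finset.sum_le_sum fun s (_ : s ∈ Finset.univ) => hdle s
  have he0 := Finset.sum_le_sum fun s (_ : s ∈ Finset.univ) => hele s
  simp only [Finset.sum_sub_distrib, Finset.sum_ite_eq', Finset.mem_univ, if_true]
    at hd0 he0
  have hmid := hall (fun s => ((d s : ℚ) + e s) / 2) (by
    have := hconv hdR heR (a := 1 / 2) (b := 1 / 2) (by norm_num) (by norm_num)
      (by norm_num)
    convert this using 1
    ext s
    simp
    ring)
  have hsub : ∀ s, 2 * max (u s * (((d s : ℚ) + e s) / 2)) (ℓ s * ((d s + e s) / 2)) ≤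
      ((max (u s * d s) (ℓ s * d s) + max (u s * e s) (ℓ s * e s) -
        (if s = t then 1 else 0) : ℤ) : ℚ) := fun s => by
    by_cases hs : s = t
    · subst hs
      have h1 : max (u s * d s) (ℓ s * d s) = - ℓ s := by rw [hdt]; simp; lia
      have h2 : max (u s * e s) (ℓ s * e s) = u s := by rw [het]; simp; lia
      rw [h1, h2, hdt, het]
      have : (ℓ s : ℚ) + 1 ≤ u s := by exact_mod_cast htlt
      simp
      linarith
    · rw [if_neg hs]
      push_cast
      rw [mul_max_of_nonneg _ _ zero_le_two]
      have a1 := le_max_left ((u s : ℚ) * d s) (ℓ s * d s)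
      have a2 := le_max_right ((u s : ℚ) * d s) (ℓ s * d s)
      have a3 := le_max_left ((u s : ℚ) * e s) (ℓ s * e s)
      have a4 := le_max_right ((u s : ℚ) * e s) (ℓ s * e s)
      refine max_le ?_ ?_ <;> linarith
  have hfin := Finset.sum_le_sum fun s (_ : s ∈ Finset.univ) => hsub s
  rw [← Finset.mul_sum, ← Int.cast_sum] at hfin
  have hfin' : (0 : ℚ) ≤ ((∑ s, (max (u s * d s) (ℓ s * d s) +
      max (u s * e s) (ℓ s * e s) - (if s = t then 1 else 0)) : ℤ) : ℚ) := by
    linarith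
  have hfin'' := Int.cast_nonneg_iff.mp hfin'
  simp only [Finset.sum_add_distrib, Finset.sum_sub_distrib, Finset.sum_ite_eq',
    Finset.mem_univ, if_true] at hfin''
  lia

theorem EReal.coe_intCast_sum {S : Type} (X : Finset S) (F : S → ℤ) :
    (((∑ s ∈ X, F s : ℤ) : ℝ) : EReal) = ∑ s ∈ X, ((F s : ℝ) : EReal) := by
  classical
  induction X using Finset.induction_on with
  | empty => simp
  | insert s X hs ih =>
    rw [Finset.sum_insert hs, Finset.sum_insert hs, ← ih, Int.cast_add, EReal.coe_add]

/-- Infinite bounds can be replaced by finite integral ones without affecting the condition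
on pairs of subsets. -/
theorem exists_finite_bounds {S : Type} [Fintype S] {ℓ u : S → EReal}
    (hℓ : ∀ s, ℓ s = ⊥ ∨ ∃ k : ℤ, ℓ s = ((k : ℝ) : EReal))
    (hu : ∀ s, u s = ⊤ ∨ ∃ k : ℤ, u s = ((k : ℝ) : EReal)) (hlu : ℓ ≤ u) :
    ∃ ℓ' u' : S → ℤ, ℓ' ≤ u' ∧ (∀ s, ℓ s ≤ ((ℓ' s : ℝ) : EReal)) ∧
      (∀ s, ((u' s : ℝ) : EReal) ≤ u s) ∧
      ∀ X Y : Finset S, ∑ s ∈ X, ℓ s ≤ ∑ s ∈ Y, u s → ∑ s ∈ X, ℓ' s ≤ ∑ s ∈ Y, u' s := by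
  classical
  have hℓ' : ∀ s, ∃ k : ℤ, ℓ s = ⊥ ∨ ℓ s = ((k : ℝ) : EReal) := fun s => by
    rcases hℓ s with h | ⟨k, h⟩
    exacts [⟨0, .inl h⟩, ⟨k, .inr h⟩]
  have hu' : ∀ s, ∃ k : ℤ, u s = ⊤ ∨ u s = ((k : ℝ) : EReal) := fun s => by
    rcases hu s with h | ⟨k, h⟩
    exacts [⟨0, .inl h⟩, ⟨k, .inr h⟩]
  choose L hL using hℓ'
  choose U hU using hu'
  set NL := ∑ s, |L s| with hNL
  set NU := ∑ s, |U s| with hNU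
  have habs : ∀ (F : S → ℤ) (X : Finset S), ∑ s ∈ X, |F s| ≤ ∑ s, |F s| := fun F X =>
    Finset.sum_le_sum_of_subset_of_nonneg (Finset.subset_univ X) fun _ _ _ => abs_nonneg _
  have hLs : ∀ s, |L s| ≤ NL := fun s => by simpa using habs L {s}
  have hUs : ∀ s, |U s| ≤ NU := fun s => by simpa using habs U {s}
  have hNL0 : 0 ≤ NL := Finset.sum_nonneg fun _ _ => abs_nonneg _
  have hNU0 : 0 ≤ NU := Finset.sum_nonneg fun _ _ => abs_nonneg _
  set ℓ' : S → ℤ := fun s => if ℓ s = ⊥ then -(NL + NU) else L s with hdℓ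
  set u' : S → ℤ := fun s => if u s = ⊤ then NL + NU else U s with hdu
  have hle : ∀ s, ℓ' s ≤ |L s| := fun s => by
    simp only [hdℓ]
    split_ifs
    · have := abs_nonneg (L s); lia
    · exact le_abs_self _
  have hge : ∀ s, -|U s| ≤ u' s := fun s => by
    simp only [hdu]
    split_ifs
    · have := abs_nonneg (U s); lia
    · exact neg_abs_le _
  have hsumle : ∀ X : Finset S, ∑ s ∈ X, ℓ' s ≤ NL := fun X =>
    (Finset.sum_le_sum fun s _ => hle s).trans (habs L X)
  have hsumge : ∀ X : Finset S, -NU ≤ ∑ s ∈ X, u' s := fun X => by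
    have := Finset.sum_le_sum fun s (_ : s ∈ X) => hge s
    rw [Finset.sum_neg_distrib] at this
    have := habs U X
    lia
  refine ⟨ℓ', u', fun s => ?_, fun s => ?_, fun s => ?_, fun X Y hXY => ?_⟩
  · have h1 := abs_le.mp (hLs s)
    have h2 := abs_le.mp (hUs s)
    simp only [hdℓ, hdu]
    split_ifs with h3 h4 h4
    · lia
    · lia
    · lia
    · have := hlu s
      rw [(hL s).resolve_left h3, (hU s).resolve_left h4, EReal.coe_le_coe_iff] at this
      exact_mod_cast this
  · by_cases h : ℓ s = ⊥
    · simp [h]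
    · simp only [hdℓ, if_neg h]
      exact ((hL s).resolve_left h).le
  · by_cases h : u s = ⊤
    · simp [h]
    · simp only [hdu, if_neg h]
      exact ((hU s).resolve_left h).ge
  · by_cases hX : ∃ t ∈ X, ℓ t = ⊥
    · obtain ⟨t, ht, htb⟩ := hX
      rw [← Finset.add_sum_erase X ℓ' ht]
      have h1 : ℓ' t = -(NL + NU) := if_pos htb
      have h2 := hsumle (X.erase t)
      have h3 := hsumge Y
      lia
    by_cases hY : ∃ t ∈ Y, u t = ⊤
    · obtain ⟨t, ht, htb⟩ := hY
      rw [← Finset.add_sum_erase Y u' ht]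
      have h1 : u' t = NL + NU := if_pos htb
      have h2 := hsumle X
      have h3 := hsumge (Y.erase t)
      lia
    push Not at hX hY
    have e1 : ∑ s ∈ X, ℓ s = ((∑ s ∈ X, ℓ' s : ℤ) : ℝ) := by
      rw [EReal.coe_intCast_sum]
      refine Finset.sum_congr rfl fun s hs => ?_
      simp only [hdℓ, if_neg (hX s hs)]
      exact (hL s).resolve_left (hX s hs)
    have e2 : ∑ s ∈ Y, u s = ((∑ s ∈ Y, u' s : ℤ) : ℝ) := by
      rw [EReal.coe_intCast_sum]
      refine Finset.sum_congr rfl fun s hs => ?_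
      simp only [hdu, if_neg (hY s hs)]
      exact (hU s).resolve_left (hY s hs)
    rw [e1, e2] at hXY
    exact_mod_cast hXY

/-- Let `Q x ≥ p` be a box-TDI system with integral data,
`R = {x : Q x ≥ p}`, `z*` an integral element of `R`, and `ℓ ≤ u` integer-valued bounding
vectors possibly taking the values `-∞` resp. `+∞`. There is an integer-valued cost
function `w*` with `ℓ ≤ w* ≤ u` for which `z*` is a `w*`-minimizer of `R` iff
`ℓ̃(S⁻) ≤ ũ(S⁺)` for every pair of disjoint subsets `(S⁻, S⁺)` of `S` with
`z* + χ_{S⁺} - χ_{S⁻} ∈ R`. -/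
theorem exists_cost_function_iff {m : ℕ} {S : Type} [Fintype S] [DecidableEq S]
    (Q : Matrix (Fin m) S ℤ) (p : Fin m → ℤ)
    (hbox : IsBoxTDI (Q.map (Int.cast : ℤ → ℚ)) fun i => (p i : ℚ))
    (zstar : S → ℤ)
    (hz : (fun i => (p i : ℚ)) ≤ (Q.map (Int.cast : ℤ → ℚ)) *ᵥ fun s => (zstar s : ℚ))
    (ℓ u : S → EReal)
    (hℓ : ∀ s, ℓ s = ⊥ ∨ ∃ k : ℤ, ℓ s = ((k : ℝ) : EReal))
    (hu : ∀ s, u s = ⊤ ∨ ∃ k : ℤ, u s = ((k : ℝ) : EReal))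
    (hlu : ℓ ≤ u) :
    (∃ w : S → ℤ,
        (∀ s, ℓ s ≤ ((w s : ℝ) : EReal) ∧ ((w s : ℝ) : EReal) ≤ u s) ∧
        ∀ x : S → ℚ, (fun i => (p i : ℚ)) ≤ (Q.map (Int.cast : ℤ → ℚ)) *ᵥ x →
          (fun s => (w s : ℚ)) ⬝ᵥ (fun s => (zstar s : ℚ)) ≤ (fun s => (w s : ℚ)) ⬝ᵥ x) ↔
      ∀ Sneg Spos : Finset S, Disjoint Sneg Spos →
        ((fun i => (p i : ℚ)) ≤ (Q.map (Int.cast : ℤ → ℚ)) *ᵥ fun s =>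
          ((zstar s + (if s ∈ Spos then 1 else 0) - (if s ∈ Sneg then 1 else 0) : ℤ) : ℚ)) →
        ∑ s ∈ Sneg, ℓ s ≤ ∑ s ∈ Spos, u s := by
  set R : Set (S → ℚ) :=
    {x | (fun i => (p i : ℚ)) ≤ Q.map (Int.cast : ℤ → ℚ) *ᵥ x}
  constructor
  · rintro ⟨w, hw, hmin⟩ Sneg Spos - hmem
    have h := hmin _ hmem
    have hsum : ∑ s ∈ Sneg, w s ≤ ∑ s ∈ Spos, w s := by
      simp only [dotProduct] at h
      have h' : ∑ s, w s * zstar s ≤ ∑ s, w s * (zstar s +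
          (if s ∈ Spos then 1 else 0) - (if s ∈ Sneg then 1 else 0)) := by
        exact_mod_cast h
      simp only [mul_sub, mul_add, Finset.sum_add_distrib, Finset.sum_sub_distrib,
        mul_ite, mul_one, mul_zero, Finset.sum_ite_mem, Finset.univ_inter] at h'
      lia
    calc ∑ s ∈ Sneg, ℓ s ≤ ∑ s ∈ Sneg, ((w s : ℝ) : EReal) :=
          Finset.sum_le_sum fun s _ => (hw s).1
      _ = ((∑ s ∈ Sneg, w s : ℤ) : ℝ) := (EReal.coe_intCast_sum _ _).symm
      _ ≤ ((∑ s ∈ Spos, w s : ℤ) : ℝ) := by exact_mod_cast hsum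
      _ = ∑ s ∈ Spos, ((w s : ℝ) : EReal) := EReal.coe_intCast_sum _ _
      _ ≤ ∑ s ∈ Spos, u s := Finset.sum_le_sum fun s _ => (hw s).2
  · intro hcond
    obtain ⟨ℓ', u', hlu', hℓℓ', huu', hsum⟩ := exists_finite_bounds hℓ hu hlu
    have hconv : Convex ℚ R := by
      intro x hx y hy a b ha hb hab i
      have h1 := mul_le_mul_of_nonneg_left (hx i) ha
      have h2 := mul_le_mul_of_nonneg_left (hy i) hb
      have h3 : (p i : ℚ) = a * p i + b * p i := by rw [← add_mul, hab, one_mul]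
      simp only [mulVec_add, mulVec_smul, Pi.add_apply, Pi.smul_apply, smul_eq_mul]
      linarith
    obtain ⟨w, hw, hmin⟩ := hbox.isBoxIntegral.exists_cost_of_finite_bounds hconv
      (z := zstar) hz ℓ' u' hlu' (by
        intro d hd hdR
        have hdz : ∀ s, d s = (if s ∈ Finset.univ.filter (fun s => d s = 1) then 1 else 0) -
            (if s ∈ Finset.univ.filter (fun s => d s = -1) then 1 else 0) := fun s => by
          have := hd s
          simp only [Finset.mem_filter, Finset.mem_univ, true_and]
          split_ifs <;> lia
        have := hsum _ _ (hcond (Finset.univ.filter fun s => d s = -1)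
          (Finset.univ.filter fun s => d s = 1)
          (Finset.disjoint_filter.mpr fun s _ h1 h2 => by lia) (by
            simpa only [add_sub_assoc, ← hdz, Set.mem_ofPred_eq] using hdR))
        rw [← sub_nonneg, Finset.sum_filter, Finset.sum_filter,
          ← Finset.sum_sub_distrib] at this
        refine this.trans (Finset.sum_le_sum fun s _ => ?_)
        obtain h | h | h : d s = -1 ∨ d s = 0 ∨ d s = 1 := by
          have := hd s
          lia
        all_goals simp [h])
    refine ⟨w, fun s => ⟨(hℓℓ' s).trans ?_, le_trans ?_ (huu' s)⟩, fun x hx => ?_⟩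
    · exact_mod_cast (hw s).1
    · exact_mod_cast (hw s).2
    · have := hmin (fun s => x s - zstar s) (by simpa using hx)
      simp only [mul_sub, Finset.sum_sub_distrib] at this
      simp only [dotProduct]
      linarith
end

section
/- Let R = {x : Qx ≥ p} ⊆ ℝ^S be an integral polyhedron (Q integral, p integral) and let φ_s be arbitrary integer-valued functions on ℤ for s ∈ S, with discrete conjugates φ_s• and Φ(z) := Σ_{s∈S} φ_s(z(s)), Φ•(w) := Σ_{s∈S} φ_s•(w(s)). Then: (i) for every z ∈ R ∩ ℤ^S and every integer-valued vector y ≥ 0 (indexed by the rows of Q), Φ(z) ≥ yp − Φ•(yQ); (ii) if equality holds for some z* ∈ R ∩ ℤ^S and y* ≥ 0, then z* is a Φ-minimizer of R ∩ ℤ^S and the pair (z*, y*Q) is Φ-fitting. -/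
open Matrix

/-- Membership in the polyhedron `R = {x : Q x ≥ p}`. -/
def memR {m : ℕ} {S : Type} [Fintype S] (Q : Matrix (Fin m) S ℤ) (p : Fin m → ℤ)
    (x : S → ℚ) : Prop :=
  (fun i => (p i : ℚ)) ≤ (Q.map (Int.cast : ℤ → ℚ)) *ᵥ x

/-- The discrete conjugate `φ•(ℓ) = sup {kℓ - φ(k) : k ∈ ℤ}` of an integer-valued
function `φ`, valued in the extended reals. -/
noncomputable def discreteConj (φ : ℤ → ℤ) (l : ℤ) : EReal :=
  ⨆ k : ℤ, (((k * l - φ k : ℤ) : ℝ) : EReal)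

/-- Every integral point gives a lower bound for the sum of the discrete conjugates. -/
lemma coe_sum_le_sum_discreteConj {S : Type} [Fintype S] (φ : S → ℤ → ℤ) (w k : S → ℤ) :
    (((∑ s, (k s * w s - φ s (k s)) : ℤ) : ℝ) : EReal) ≤ ∑ s, discreteConj (φ s) (w s) := by
  have h : (((∑ s, (k s * w s - φ s (k s)) : ℤ) : ℝ) : EReal) =
      ∑ s, (((k s * w s - φ s (k s) : ℤ) : ℝ) : EReal) :=
    map_sum (AddMonoidHom.comp ⟨⟨Real.toEReal, EReal.coe_zero⟩, EReal.coe_add⟩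
      (Int.castAddHom ℝ)) _ _
  rw [h]
  exact Finset.sum_le_sum fun s _ =>
    le_iSup (fun j : ℤ => (((j * w s - φ s j : ℤ) : ℝ) : EReal)) (k s)

/-- Weak duality: a nonnegative combination of the constraints of `Q x ≥ p` holds on `R`. -/
lemma memR.dotProduct_le {m : ℕ} {S : Type} [Fintype S] {Q : Matrix (Fin m) S ℤ}
    {p : Fin m → ℤ} {z : S → ℤ} (hz : memR Q p (fun s => (z s : ℚ))) {y : Fin m → ℤ}
    (hy : 0 ≤ y) : y ⬝ᵥ p ≤ ∑ s, z s * (y ᵥ* Q) s := by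
  have hle : p ≤ Q *ᵥ z := fun i => by
    have h : (p i : ℚ) ≤ ∑ s, (Q i s : ℚ) * (z s : ℚ) := hz i
    exact_mod_cast h
  calc y ⬝ᵥ p ≤ y ⬝ᵥ (Q *ᵥ z) := dotProduct_le_dotProduct_of_nonneg_left hle hy
    _ = z ⬝ᵥ (y ᵥ* Q) := by rw [dotProduct_mulVec, dotProduct_comm]

/-- Let `R = {x : Qx ≥ p}` be an integral polyhedron and `φ_s` arbitrary
integer-valued functions with conjugates `φ_s•`. (i) For every `z ∈ R ∩ ℤ^S` and integral
`y ≥ 0`, `Φ(z) ≥ y p - Φ•(y Q)`; (ii) if equality holds for some `z*, y*`, then `z*` is a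
`Φ`-minimizer of `R ∩ ℤ^S` and `(z*, y* Q)` is `Φ`-fitting. -/
theorem conjugate_lower_bound_and_optimality {m : ℕ} {S : Type} [Fintype S] [DecidableEq S]
    (Q : Matrix (Fin m) S ℤ) (p : Fin m → ℤ)
    (hint : {x : S → ℚ | memR Q p x} =
      convexHull ℚ {x : S → ℚ | memR Q p x ∧ ∀ s, ∃ k : ℤ, x s = k})
    (φ : S → ℤ → ℤ) :
    (∀ z : S → ℤ, memR Q p (fun s => (z s : ℚ)) → ∀ y : Fin m → ℤ, 0 ≤ y →
      (((y ⬝ᵥ p : ℤ) : ℝ) : EReal) ≤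
        (((∑ s, φ s (z s) : ℤ) : ℝ) : EReal) + ∑ s, discreteConj (φ s) ((y ᵥ* Q) s)) ∧
    (∀ zstar : S → ℤ, memR Q p (fun s => (zstar s : ℚ)) → ∀ ystar : Fin m → ℤ, 0 ≤ ystar →
      ((((ystar ⬝ᵥ p : ℤ) : ℝ) : EReal) =
        (((∑ s, φ s (zstar s) : ℤ) : ℝ) : EReal) +
          ∑ s, discreteConj (φ s) ((ystar ᵥ* Q) s)) →
      (∀ z : S → ℤ, memR Q p (fun s => (z s : ℚ)) →
        ∑ s, φ s (zstar s) ≤ ∑ s, φ s (z s)) ∧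
      (∀ s, φ s (zstar s) - φ s (zstar s - 1) ≤ (ystar ᵥ* Q) s ∧
        (ystar ᵥ* Q) s ≤ φ s (zstar s + 1) - φ s (zstar s))) := by
  refine ⟨fun z hz y hy => ?_, fun zstar hzstar ystar hy heq => ?_⟩
  · refine le_trans ?_ (add_le_add_right (coe_sum_le_sum_discreteConj φ (y ᵥ* Q) z) _)
    have h := hz.dotProduct_le hy
    rw [← EReal.coe_add, EReal.coe_le_coe_iff, ← Int.cast_add, Int.cast_le,
      Finset.sum_sub_distrib]
    linarith
  · have key (k : S → ℤ) : ∑ s, φ s (zstar s) +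
        ∑ s, (k s * (ystar ᵥ* Q) s - φ s (k s)) ≤ ystar ⬝ᵥ p := by
      have h := add_le_add_right (coe_sum_le_sum_discreteConj φ (ystar ᵥ* Q) k)
        (((∑ s, φ s (zstar s) : ℤ) : ℝ) : EReal)
      rwa [← heq, ← EReal.coe_add, EReal.coe_le_coe_iff, ← Int.cast_add, Int.cast_le] at h
    refine ⟨fun z hz => ?_, fun s => ?_⟩
    · have h := key z
      have hle := hz.dotProduct_le hy
      rw [Finset.sum_sub_distrib] at h
      linarith
    · have hsub (t : ℤ) : t * (ystar ᵥ* Q) s - φ s t ≤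
          zstar s * (ystar ᵥ* Q) s - φ s (zstar s) := by
        have h := key (Function.update zstar s t)
        have hle := hzstar.dotProduct_le hy
        have hdiff : ∑ r, (Function.update zstar s t r * (ystar ᵥ* Q) r -
              φ r (Function.update zstar s t r)) -
            ∑ r, (zstar r * (ystar ᵥ* Q) r - φ r (zstar r)) =
            (t * (ystar ᵥ* Q) s - φ s t) -
              (zstar s * (ystar ᵥ* Q) s - φ s (zstar s)) := by
          rw [← Finset.sum_sub_distrib, Finset.sum_eq_single s]
          · simp
          · intro r _ hr
            simp [hr]
          · simp
        rw [Finset.sum_sub_distrib (fun r => zstar r * (ystar ᵥ* Q) r)] at hdiff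
        linarith
      have h₁ := hsub (zstar s - 1)
      have h₂ := hsub (zstar s + 1)
      constructor <;> linarith
end
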